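/- Fix a real constant C̄ > 0, an integer k ≥ 2, and a real number r₁ > 0. Suppose β : (0, r₁) → (0,∞) is non-decreasing and for almost every r ∈ (0, r₁) (with respect to Lebesgue measure) β is differentiable at r with β(r) ≤ C̄·(β'(r))^{k/(k-1)}. Then β(r) ≥ r^k / (C̄^{k-1}·k^k) for all r ∈ (0, r₁). -/

import Mathlib

open MeasureTheory Set

/-- A monotone function whose derivative is almost everywhere at least `c` grows at least linearly
with slope `c`, even if it is not absolutely continuous. -/
theorem MonotoneOn.mul_sub_le_sub_of_ae_le_deriv {f : ℝ → ℝ} {a b c : ℝ} (hab : a ≤ b)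
    (hf : MonotoneOn f (Icc a b)) (hc : ∀ᵐ x ∂(volume.restrict (Icc a b)), c ≤ deriv f x) :
    c * (b - a) ≤ f b - f a := by
  rw [← uIcc_of_le hab] at hf
  have hle : f a ≤ f b := hf left_mem_uIcc right_mem_uIcc hab
  have hint := hf.intervalIntegral_deriv_mem_uIcc
  rw [uIcc_of_le (sub_nonneg.mpr hle)] at hint
  have hmono := intervalIntegral.integral_mono_ae_restrict hab
    (intervalIntegrable_const (μ := volume) (c := c)) hf.intervalIntegrable_deriv hc
  rw [intervalIntegral.integral_const, smul_eq_mul, mul_comm] at hmono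
  exact hmono.trans hint.2

/-- The differential inequality `b ≤ C d ^ (k / (k - 1))` for a function with value `b` and
derivative `d`, rewritten as a lower bound for the derivative of its `k`-th root. -/
theorem Real.inv_mul_rpow_le_of_le_mul_rpow {C b d k : ℝ} (hC : 0 < C) (hb : 0 < b) (hd : 0 ≤ d)
    (hk : 1 < k) (h : b ≤ C * d ^ (k / (k - 1))) :
    (k * C ^ (1 - k⁻¹))⁻¹ ≤ d * k⁻¹ * b ^ (k⁻¹ - 1) := by
  have hk0 : 0 < k := by linarith
  have hk1 : 0 < k - 1 := by linarith
  have hexp : k / (k - 1) * (1 - k⁻¹) = 1 := by field_simp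
  have hq : 0 ≤ 1 - k⁻¹ := sub_nonneg.mpr (inv_le_one_of_one_le₀ hk.le)
  have hroot : b ^ (1 - k⁻¹) ≤ C ^ (1 - k⁻¹) * d := by
    calc b ^ (1 - k⁻¹) ≤ (C * d ^ (k / (k - 1))) ^ (1 - k⁻¹) := Real.rpow_le_rpow hb.le h hq
      _ = C ^ (1 - k⁻¹) * d := by
        rw [Real.mul_rpow hC.le (by positivity), ← Real.rpow_mul hd, hexp, Real.rpow_one]
  have hbq : 0 < b ^ (1 - k⁻¹) := by positivity
  have hCq : 0 < C ^ (1 - k⁻¹) := by positivity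
  rw [← neg_sub 1 k⁻¹, Real.rpow_neg hb.le, mul_inv, mul_right_comm, mul_comm k⁻¹]
  gcongr
  rw [← div_eq_mul_inv, le_div_iff₀ hbq, inv_mul_le_iff₀ hCq]
  exact hroot

/-- Variant of the growth lemma with initial radius `0`: if `β : (0, r₁) → (0,∞)` is
non-decreasing and for a.e. `r ∈ (0, r₁)` the function `β` is differentiable at `r`
with `β r ≤ C (β' r)^(k/(k-1))`, then `β r ≥ r^k / (C^(k-1) k^k)` on `(0, r₁)`. -/
theorem growth_lemma_from_zero (C : ℝ) (hC : 0 < C) (k : ℕ) (hk : 2 ≤ k)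
    (r₁ : ℝ) (hr₁ : 0 < r₁)
    (β : ℝ → ℝ)
    (hmono : MonotoneOn β (Ioo 0 r₁))
    (hpos : ∀ r ∈ Ioo 0 r₁, 0 < β r)
    (hdiff : ∀ᵐ r ∂(volume.restrict (Ioo 0 r₁)),
      DifferentiableAt ℝ β r ∧
        β r ≤ C * (deriv β r) ^ ((k : ℝ) / ((k : ℝ) - 1))) :
    ∀ r ∈ Ioo 0 r₁, r ^ k / (C ^ (k - 1) * (k : ℝ) ^ k) ≤ β r := by
  intro r hr
  have hk1 : (1 : ℝ) < k := by exact_mod_cast hk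
  have hk0 : k ≠ 0 := by omega
  set c : ℝ := ((k : ℝ) * C ^ (1 - (k : ℝ)⁻¹))⁻¹ with hc
  have hc0 : 0 < c := by positivity
  let g : ℝ → ℝ := fun x => β x ^ (k : ℝ)⁻¹
  have hgmono : MonotoneOn g (Ioo 0 r₁) := fun x hx y hy hxy =>
    Real.rpow_le_rpow (hpos x hx).le (hmono hx hy hxy) (by positivity)
  have hgpos : ∀ x ∈ Ioo 0 r₁, 0 < g x := fun x hx => Real.rpow_pos_of_pos (hpos x hx) _
  have hderiv : ∀ᵐ x ∂(volume.restrict (Ioo 0 r₁)), c ≤ deriv g x := by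
    filter_upwards [hdiff, ae_restrict_mem measurableSet_Ioo] with x ⟨hdx, hle⟩ hx
    have hd : 0 ≤ deriv β x := by
      rw [← derivWithin_of_isOpen isOpen_Ioo hx]
      exact hmono.derivWithin_nonneg
    rw [_root_.deriv_rpow_const hdx (Or.inl (hpos x hx).ne')]
    exact Real.inv_mul_rpow_le_of_le_mul_rpow hC (hpos x hx) hd hk1 hle
  have hsub : ∀ a ∈ Ioo 0 r, c * (r - a) ≤ g r := fun a ha => by
    have hsubset : Icc a r ⊆ Ioo 0 r₁ := Icc_subset_Ioo ha.1 hr.2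
    have := (hgmono.mono hsubset).mul_sub_le_sub_of_ae_le_deriv ha.2.le
      (ae_restrict_of_ae_restrict_of_subset hsubset hderiv)
    linarith [hgpos a (hsubset (left_mem_Icc.mpr ha.2.le))]
  have hlin : c * r ≤ g r := by
    have hcont : Continuous fun a : ℝ => c * (r - a) := by fun_prop
    have hlim := (hcont.tendsto 0).mono_left (nhdsWithin_le_nhds (s := Ioi 0))
    rw [sub_zero] at hlim
    refine le_of_tendsto hlim ?_
    filter_upwards [Ioo_mem_nhdsGT hr.1] with a ha using hsub a ha
  have hCpow : (C ^ (1 - (k : ℝ)⁻¹)) ^ k = C ^ (k - 1) := by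
    rw [← Real.rpow_natCast, ← Real.rpow_mul hC.le, ← Real.rpow_natCast C (k - 1),
      Nat.cast_sub (by omega), sub_mul, inv_mul_cancel₀ (by positivity), one_mul, Nat.cast_one]
  calc r ^ k / (C ^ (k - 1) * (k : ℝ) ^ k) = (c * r) ^ k := by
        rw [hc, mul_pow, inv_pow, mul_pow, hCpow, mul_comm ((k : ℝ) ^ k), div_eq_inv_mul]
    _ ≤ g r ^ k := pow_le_pow_left₀ (mul_nonneg hc0.le hr.1.le) hlin k
    _ = β r := Real.rpow_inv_natCast_pow (hpos r hr).le hk0
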